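/- arXiv:1707.07285 — 8 statements merged into one kernel-verified Lean document; each statement's English description precedes it below -/
import Mathlib

section
/- Let z be an n×n matrix with all entries strictly positive and let μ ∈ ℝ^n have all entries strictly positive. Then the matrix x* defined by x*_{ij} = (z_{ij} / ∑_s z_{is}) · μ_i belongs to RS(μ) and minimizes KL(x | z) over RS(μ); that is, x* ∈ RS(μ) and KL(x* | z) ≤ KL(x | z) for every x ∈ RS(μ). -/
/-- KL divergence for matrices (convention `0 * log 0 = 0` is automatic
since `Real.log 0 = 0`). -/
noncomputable def KLmat (n : ℕ) (x z : Fin n → Fin n → ℝ) : ℝ :=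
  ∑ i, ∑ j, x i j * (Real.log (x i j / z i j) - 1)

/-- The row-stochastic polytope `RS(μ)`. -/
def RS (n : ℕ) (μ : Fin n → ℝ) : Set (Fin n → Fin n → ℝ) :=
  {x | (∀ i j, 0 ≤ x i j) ∧ ∀ i, ∑ j, x i j = μ i}

theorem kl_projection_rowStochastic {n : ℕ} (z : Fin n → Fin n → ℝ) (μ : Fin n → ℝ)
    (hz : ∀ i j, 0 < z i j) (hμ : ∀ i, 0 < μ i)
    (xstar : Fin n → Fin n → ℝ)
    (hxstar : ∀ i j, xstar i j = z i j / (∑ s, z i s) * μ i) :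
    xstar ∈ RS n μ ∧ ∀ x ∈ RS n μ, KLmat n xstar z ≤ KLmat n x z := by
  have hS : ∀ i : Fin n, 0 < ∑ s, z i s := fun i =>
    Finset.sum_pos (fun j _ => hz i j) ⟨i, Finset.mem_univ i⟩
  have hpos : ∀ i j, 0 < xstar i j := fun i j => by
    rw [hxstar]
    exact mul_pos (div_pos (hz i j) (hS i)) (hμ i)
  have hsum : ∀ i, ∑ j, xstar i j = μ i := fun i => by
    simp_rw [hxstar]
    rw [← Finset.sum_mul, ← Finset.sum_div, div_self (hS i).ne', one_mul]
  refine ⟨⟨fun i j => (hpos i j).le, hsum⟩, ?_⟩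
  rintro x ⟨hx0, hx1⟩
  unfold KLmat
  refine Finset.sum_le_sum fun i _ => ?_
  set c := μ i / ∑ s, z i s with hc
  have hcz : ∀ j, xstar i j / z i j = c := fun j => by
    rw [hxstar, hc]
    have h1 := (hz i j).ne'
    have h2 := (hS i).ne'
    field_simp
  have key : ∀ j, x i j * Real.log c - xstar i j ≤
      x i j * (Real.log (x i j / z i j) - 1) := fun j => by
    rcases (hx0 i j).eq_or_lt with h | h
    · rw [← h]
      have := hpos i j
      simp only [zero_mul]
      linarith
    · have h3 := Real.log_le_sub_one_of_pos (div_pos (hpos i j) h)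
      have h4 : Real.log (xstar i j / x i j) =
          Real.log c - Real.log (x i j / z i j) := by
        rw [← hcz j, Real.log_div (hpos i j).ne' h.ne',
          Real.log_div (hpos i j).ne' (hz i j).ne', Real.log_div h.ne' (hz i j).ne']
        ring
      rw [h4] at h3
      have h5 := mul_le_mul_of_nonneg_left h3 h.le
      have h6 : x i j * (xstar i j / x i j - 1) = xstar i j - x i j := by
        have := h.ne'
        field_simp
      rw [h6] at h5
      linarith
  calc ∑ j, xstar i j * (Real.log (xstar i j / z i j) - 1)
      = ∑ j, (x i j * Real.log c - xstar i j) := by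
        simp_rw [hcz]
        rw [← Finset.sum_mul, Finset.sum_sub_distrib, ← Finset.sum_mul, hsum, hx1]
        ring
    _ ≤ _ := Finset.sum_le_sum fun j _ => key j
end

section
/- Let z be an n×n matrix with all entries strictly positive and let ν ∈ ℝ^n have all entries strictly positive. Then the matrix x* defined by x*_{ij} = (z_{ij} / ∑_s z_{sj}) · ν_j belongs to CS(ν) and minimizes KL(x | z) over CS(ν); that is, x* ∈ CS(ν) and KL(x* | z) ≤ KL(x | z) for every x ∈ CS(ν). -/
/-- The column-stochastic polytope `CS(ν)`. -/
def CS (n : ℕ) (ν : Fin n → ℝ) : Set (Fin n → Fin n → ℝ) :=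
  {x | (∀ i j, 0 ≤ x i j) ∧ ∀ j, ∑ i, x i j = ν j}

theorem kl_projection_colStochastic {n : ℕ} (z : Fin n → Fin n → ℝ) (ν : Fin n → ℝ)
    (hz : ∀ i j, 0 < z i j) (hν : ∀ j, 0 < ν j)
    (xstar : Fin n → Fin n → ℝ)
    (hxstar : ∀ i j, xstar i j = z i j / (∑ s, z s j) * ν j) :
    xstar ∈ CS n ν ∧ ∀ x ∈ CS n ν, KLmat n xstar z ≤ KLmat n x z := by
  have hS : ∀ j : Fin n, 0 < ∑ s, z s j := fun j =>
    Finset.sum_pos (fun i _ => hz i j) ⟨j, Finset.mem_univ j⟩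
  have hsum : ∀ j, ∑ i, xstar i j = ν j := by
    intro j
    simp only [hxstar]
    rw [← Finset.sum_mul, ← Finset.sum_div, div_self (hS j).ne', one_mul]
  have hpos : ∀ i j, 0 < xstar i j := by
    intro i j
    rw [hxstar]
    exact mul_pos (div_pos (hz i j) (hS j)) (hν j)
  refine ⟨⟨fun i j => (hpos i j).le, hsum⟩, ?_⟩
  rintro x ⟨hx0, hxs⟩
  unfold KLmat
  rw [Finset.sum_comm, Finset.sum_comm (f := fun i j => x i j * (Real.log (x i j / z i j) - 1))]
  refine Finset.sum_le_sum fun j _ => ?_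
  have hr : ∀ i, xstar i j / z i j = ν j / ∑ s, z s j := by
    intro i
    rw [hxstar]
    have := (hz i j).ne'
    have := (hS j).ne'
    field_simp
  have key : ∀ i, x i j * Real.log (ν j / ∑ s, z s j) - xstar i j
      ≤ x i j * (Real.log (x i j / z i j) - 1) := by
    intro i
    rcases (hx0 i j).eq_or_lt with h | h
    · rw [← h]
      have := hpos i j
      simp only [zero_mul]
      linarith
    · have h1 := Real.log_le_sub_one_of_pos (div_pos (hpos i j) h)
      have h2 := mul_le_mul_of_nonneg_left h1 h.le
      rw [← hr i, Real.log_div (hpos i j).ne' (hz i j).ne', Real.log_div h.ne' (hz i j).ne']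
      rw [Real.log_div (hpos i j).ne' h.ne', mul_sub, mul_sub, mul_div_cancel₀ _ h.ne'] at h2
      linarith
  calc ∑ i, xstar i j * (Real.log (xstar i j / z i j) - 1)
      = ∑ i, (x i j * Real.log (ν j / ∑ s, z s j) - xstar i j) := by
        simp only [hr]
        rw [← Finset.sum_mul, Finset.sum_sub_distrib, ← Finset.sum_mul, hsum, hxs]
        ring
    _ ≤ _ := Finset.sum_le_sum fun i _ => key i
end

section
/- Let z ∈ ℝ^{n×n} and w ∈ ℝ^{n²×n²} (indexed w_{ijkl}, i,j,k,l ∈ {1,…,n}) have all entries strictly positive. Define q_{ij} = exp( (∑_k log(∑_s w_{ijks}) + log z_{ij}) / (n+1) ), x*_{ij} = q_{ij} / ∑_j q_{ij}, and y*_{ijkl} = x*_{ij} · w_{ijkl} / ∑_s w_{ijks}. Then (x*, y*) belongs to OLP and minimizes KL(x | z) + KL(y | w) over OLP; that is, (x*,y*) ∈ OLP and KL(x*|z) + KL(y*|w) ≤ KL(x|z) + KL(y|w) for every (x,y) ∈ OLP. -/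
lemma kl_tangent {x a c : ℝ} (hx : 0 ≤ x) (ha : 0 < a) (hc : 0 < c) :
    a * (Real.log (a / c) - 1) + (x - a) * Real.log (a / c) ≤ x * (Real.log (x / c) - 1) := by
  rcases hx.eq_or_lt with h | h
  · subst h
    simp only [zero_mul]
    nlinarith
  · rw [Real.log_div ha.ne' hc.ne', Real.log_div h.ne' hc.ne']
    have h1 := Real.log_le_sub_one_of_pos (div_pos ha h)
    rw [Real.log_div ha.ne' h.ne'] at h1
    have h2 := mul_le_mul_of_nonneg_left h1 h.le
    have h3 : x * (a / x - 1) = a - x := by field_simp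
    rw [h3] at h2
    nlinarith


/-- KL divergence for `n² × n²` tensors indexed `y i j k l`. -/
noncomputable def KLten (n : ℕ) (y w : Fin n → Fin n → Fin n → Fin n → ℝ) : ℝ :=
  ∑ i, ∑ j, ∑ k, ∑ l, y i j k l * (Real.log (y i j k l / w i j k l) - 1)

/-- The one-sided local polytope OLP. -/
def OLP (n : ℕ) :
    Set ((Fin n → Fin n → ℝ) × (Fin n → Fin n → Fin n → Fin n → ℝ)) :=
  {p | (∀ i j, 0 ≤ p.1 i j) ∧ (∀ i j k l, 0 ≤ p.2 i j k l) ∧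
    (∀ i, ∑ j, p.1 i j = 1) ∧ (∀ i j k, ∑ l, p.2 i j k l = p.1 i j)}

theorem kl_projection_OLP {n : ℕ}
    (z : Fin n → Fin n → ℝ) (w : Fin n → Fin n → Fin n → Fin n → ℝ)
    (hz : ∀ i j, 0 < z i j) (hw : ∀ i j k l, 0 < w i j k l)
    (q xstar : Fin n → Fin n → ℝ) (ystar : Fin n → Fin n → Fin n → Fin n → ℝ)
    (hq : ∀ i j, q i j =
      Real.exp (((∑ k, Real.log (∑ s, w i j k s)) + Real.log (z i j)) / (n + 1)))
    (hxstar : ∀ i j, xstar i j = q i j / ∑ j', q i j')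
    (hystar : ∀ i j k l, ystar i j k l = xstar i j * w i j k l / ∑ s, w i j k s) :
    (xstar, ystar) ∈ OLP n ∧
      ∀ p ∈ OLP n, KLmat n xstar z + KLten n ystar w ≤ KLmat n p.1 z + KLten n p.2 w := by
  have hqp : ∀ i j, 0 < q i j := fun i j => by rw [hq]; exact Real.exp_pos _
  have hQ : ∀ i, 0 < ∑ j, q i j := fun i =>
    Finset.sum_pos (fun j _ => hqp i j) ⟨i, Finset.mem_univ i⟩
  have hW : ∀ i j k, 0 < ∑ s, w i j k s := fun i j k =>
    Finset.sum_pos (fun s _ => hw i j k s) ⟨i, Finset.mem_univ i⟩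
  have hxp : ∀ i j, 0 < xstar i j := fun i j => by
    rw [hxstar]; exact div_pos (hqp i j) (hQ i)
  have hyp : ∀ i j k l, 0 < ystar i j k l := fun i j k l => by
    rw [hystar]; exact div_pos (mul_pos (hxp i j) (hw i j k l)) (hW i j k)
  have hxs : ∀ i, ∑ j, xstar i j = 1 := fun i => by
    simp only [hxstar]
    rw [← Finset.sum_div, div_self (hQ i).ne']
  have hys : ∀ i j k, ∑ l, ystar i j k l = xstar i j := fun i j k => by
    simp only [hystar]
    rw [← Finset.sum_div, ← Finset.mul_sum, mul_div_assoc, div_self (hW i j k).ne', mul_one]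
  refine ⟨⟨fun i j => (hxp i j).le, fun i j k l => (hyp i j k l).le, hxs, hys⟩, ?_⟩
  rintro ⟨x, y⟩ ⟨hx0, hy0, hx1, hy1⟩
  simp only at hx0 hy0 hx1 hy1
  simp only [KLmat, KLten]
  have hyl : ∀ i j k, (∑ l, ystar i j k l * (Real.log (ystar i j k l / w i j k l) - 1))
      + (x i j - xstar i j) * (Real.log (xstar i j) - Real.log (∑ s, w i j k s))
      ≤ ∑ l, y i j k l * (Real.log (y i j k l / w i j k l) - 1) := fun i j k => by
    have e : (x i j - xstar i j) * (Real.log (xstar i j) - Real.log (∑ s, w i j k s))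
        = ∑ l, (y i j k l - ystar i j k l) * Real.log (ystar i j k l / w i j k l) := by
      rw [← hy1 i j k, ← hys i j k, ← Finset.sum_sub_distrib, Finset.sum_mul]
      refine Finset.sum_congr rfl fun l _ => ?_
      rw [hys i j k, ← Real.log_div (hxp i j).ne' (hW i j k).ne', hystar i j k l]
      congr 2
      have := (hw i j k l).ne'
      have := (hW i j k).ne'
      field_simp
    rw [e, ← Finset.sum_add_distrib]
    exact Finset.sum_le_sum fun l _ => kl_tangent (hy0 i j k l) (hyp i j k l) (hw i j k l)
  rw [← Finset.sum_add_distrib, ← Finset.sum_add_distrib]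
  refine Finset.sum_le_sum fun i _ => ?_
  rw [← Finset.sum_add_distrib, ← Finset.sum_add_distrib]
  have hz0 : ∑ j, (x i j - xstar i j) * (-((n + 1 : ℝ) * Real.log (∑ j', q i j'))) = 0 := by
    rw [← Finset.sum_mul, Finset.sum_sub_distrib, hx1, hxs]; ring
  rw [← add_zero (∑ j, _), ← hz0, ← Finset.sum_add_distrib]
  refine Finset.sum_le_sum fun j _ => ?_
  have h1 := kl_tangent (hx0 i j) (hxp i j) (hz i j)
  have h2 := Finset.sum_le_sum (s := Finset.univ) fun k _ => hyl i j k
  rw [Finset.sum_add_distrib, ← Finset.mul_sum, Finset.sum_sub_distrib] at h2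
  simp only [Finset.sum_const, Finset.card_univ, Fintype.card_fin, nsmul_eq_mul] at h2
  have hlx : Real.log (xstar i j) = Real.log (q i j) - Real.log (∑ j', q i j') := by
    rw [hxstar, Real.log_div (hqp i j).ne' (hQ i).ne']
  have hlq : (n + 1 : ℝ) * Real.log (q i j)
      = (∑ k, Real.log (∑ s, w i j k s)) + Real.log (z i j) := by
    rw [hq, Real.log_exp]; field_simp
  have h3 : (x i j - xstar i j) * Real.log (xstar i j / z i j)
      + (x i j - xstar i j) * (n * Real.log (xstar i j) - ∑ k, Real.log (∑ s, w i j k s))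
      = (x i j - xstar i j) * (-((n + 1 : ℝ) * Real.log (∑ j', q i j'))) := by
    rw [← mul_add, Real.log_div (hxp i j).ne' (hz i j).ne', hlx]
    congr 1
    linarith
  linarith
end

section
/- Let z ∈ ℝ^{n×n} and w ∈ ℝ^{n²×n²} (indexed w_{ijkl}) have all entries strictly positive, let x ∈ ℝ^{n×n} be entrywise nonnegative, and define y by y_{ijkl} = x_{ij} · w_{ijkl} / ∑_s w_{ijks}. Then KL(x | z) + KL(y | w) = (n+1) · ∑_{ij} kl( x_{ij} | exp( (log z_{ij} + ∑_k log(∑_s w_{ijks})) / (n+1) ) ), where kl(a|b) = a(log(a/b) − 1) is the scalar KL divergence. -/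
/-- Scalar KL divergence `kl(a | b) = a * (log (a / b) - 1)`
(convention `0 * log 0 = 0` is automatic since `Real.log 0 = 0`). -/
noncomputable def klScalar (a b : ℝ) : ℝ := a * (Real.log (a / b) - 1)

theorem kl_partial_min_identity {n : ℕ}
    (z : Fin n → Fin n → ℝ) (w : Fin n → Fin n → Fin n → Fin n → ℝ)
    (hz : ∀ i j, 0 < z i j) (hw : ∀ i j k l, 0 < w i j k l)
    (x : Fin n → Fin n → ℝ) (hx : ∀ i j, 0 ≤ x i j)
    (y : Fin n → Fin n → Fin n → Fin n → ℝ)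
    (hy : ∀ i j k l, y i j k l = x i j * w i j k l / ∑ s, w i j k s) :
    KLmat n x z + KLten n y w =
      (n + 1) * ∑ i, ∑ j, klScalar (x i j)
        (Real.exp ((Real.log (z i j) + ∑ k, Real.log (∑ s, w i j k s)) / (n + 1))) := by
  have hS : ∀ i j k, 0 < ∑ s, w i j k s := fun i j k =>
    Finset.sum_pos (fun s _ => hw i j k s) ⟨k, Finset.mem_univ k⟩
  have hn : (n : ℝ) + 1 ≠ 0 := by positivity
  unfold KLmat KLten klScalar
  rw [← Finset.sum_add_distrib, Finset.mul_sum]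
  refine Finset.sum_congr rfl fun i _ => ?_
  rw [← Finset.sum_add_distrib, Finset.mul_sum]
  refine Finset.sum_congr rfl fun j _ => ?_
  rcases (hx i j).eq_or_lt with h0 | hpos
  · simp [hy, ← h0]
  have hk : ∀ k, ∑ l, y i j k l * (Real.log (y i j k l / w i j k l) - 1)
      = x i j * (Real.log (x i j) - 1) - x i j * Real.log (∑ s, w i j k s) := by
    intro k
    have hl : ∀ l, y i j k l * (Real.log (y i j k l / w i j k l) - 1)
        = w i j k l * (x i j / (∑ s, w i j k s) *
          (Real.log (x i j) - Real.log (∑ s, w i j k s) - 1)) := by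
      intro l
      have e : y i j k l / w i j k l = x i j / ∑ s, w i j k s := by
        rw [hy]
        have h1 := (hw i j k l).ne'
        have h2 := (hS i j k).ne'
        field_simp
      rw [e, Real.log_div hpos.ne' (hS i j k).ne', hy]
      ring
    rw [Finset.sum_congr rfl fun l _ => hl l, ← Finset.sum_mul]
    have h2 := (hS i j k).ne'
    generalize (∑ s, w i j k s) = S at *
    field_simp
    ring
  rw [Finset.sum_congr rfl fun k _ => hk k, Finset.sum_sub_distrib, Finset.sum_const, ← Finset.mul_sum,
    Real.log_div hpos.ne' (hz i j).ne', Real.log_div hpos.ne' (Real.exp_pos _).ne',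
    Real.log_exp]
  simp only [Finset.card_univ, Fintype.card_fin, nsmul_eq_mul]
  field_simp
  ring
end

section
/- Let P = { v ∈ ℝ^d : v ≥ 0, Av = b } contain a strictly positive vector, let c ∈ ℝ^d, let β₀ > 0, and let u₀ ∈ ℝ^d be strictly positive. For β > 0 let v*_β denote the unique minimizer over P of KL(v | u₀ · exp(−βc)) (elementwise product and exponential). Define the proximal iterates by v₀ = u₀ and v_{k+1} = the unique minimizer over P of cᵀv + β₀^{−1} KL(v | v_k). Then for every k ≥ 1, v_k = v*_{kβ₀}. -/
/-- KL divergence for vectors in `ℝ^d`. -/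
noncomputable def KLvec (d : ℕ) (v u : Fin d → ℝ) : ℝ :=
  ∑ i, v i * (Real.log (v i / u i) - 1)

/-- entropy functional with linear term -/
noncomputable def Fent {d : ℕ} (w v : Fin d → ℝ) : ℝ := ∑ i, v i * (Real.log (v i) - 1 - w i)

lemma KLvec_eq {d : ℕ} (v u : Fin d → ℝ) (hu : ∀ i, 0 < u i) :
    KLvec d v u = Fent (fun i => Real.log (u i)) v := by
  unfold KLvec Fent
  refine Finset.sum_congr rfl fun i _ => ?_
  by_cases h : v i = 0
  · simp [h]
  · rw [Real.log_div h (hu i).ne']; ring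

lemma phi_ineq (x y : ℝ) (hx : 0 ≤ x) (hy : 0 < y) : x * Real.log y - y ≤ x * Real.log x - x := by
  rcases hx.eq_or_lt with rfl | hx
  · simp; exact hy.le
  · have h := Real.log_le_sub_one_of_pos (div_pos hy hx)
    rw [Real.log_div hy.ne' hx.ne'] at h
    have h2 := mul_le_mul_of_nonneg_left h hx.le
    have h3 : x * (y / x - 1) = y - x := by field_simp
    rw [h3] at h2
    linarith

lemma grad_ineq {d : ℕ} (w x y : Fin d → ℝ) (hx : ∀ i, 0 ≤ x i) (hy : ∀ i, 0 < y i)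
    (h : Fent w x ≤ Fent w y) : 0 ≤ ∑ i, (Real.log (y i) - w i) * (y i - x i) := by
  have : Fent w y - Fent w x ≤ ∑ i, (Real.log (y i) - w i) * (y i - x i) := by
    unfold Fent
    rw [← Finset.sum_sub_distrib]
    refine Finset.sum_le_sum fun i _ => ?_
    have := phi_ineq (x i) (y i) (hx i) (hy i)
    linarith
  linarith

lemma min_pos {d m : ℕ} (A : Matrix (Fin m) (Fin d) ℝ) (b : Fin m → ℝ) (w x z : Fin d → ℝ)
    (hx : ∀ i, 0 ≤ x i) (hxA : A.mulVec x = b) (hz : ∀ i, 0 < z i) (hzA : A.mulVec z = b)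
    (hmin : ∀ u : Fin d → ℝ, (∀ i, 0 ≤ u i) → A.mulVec u = b → Fent w x ≤ Fent w u) (j : Fin d) :
    0 < x j := by
  by_contra hj
  have hj0 : x j = 0 := le_antisymm (not_lt.1 hj) (hx j)
  set C : ℝ := ∑ i, (Real.log (z i) - w i) * (z i - x i) with hC
  have key : ∀ M : ℝ, 0 ≤ M → M * z j ≤ C := by
    intro M hM
    set t := Real.exp (-M) with ht
    have ht0 : 0 < t := Real.exp_pos _
    have ht1 : t ≤ 1 := Real.exp_le_one_iff.2 (by linarith)
    set y : Fin d → ℝ := x + t • (z - x) with hy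
    have hyi : ∀ i, y i = x i + t * (z i - x i) := fun i => by simp [hy]
    have hypos : ∀ i, 0 < y i := fun i => by
      rw [hyi]
      have := mul_pos ht0 (hz i)
      have := mul_nonneg (sub_nonneg.2 ht1) (hx i)
      linarith
    have hyA : A.mulVec y = b := by
      rw [hy, Matrix.mulVec_add, Matrix.mulVec_smul, Matrix.mulVec_sub, hxA, hzA]; simp
    have h1 := grad_ineq w x y hx hypos (hmin y (fun i => (hypos i).le) hyA)
    have h2 : ∑ i, (Real.log (y i) - w i) * (y i - x i)
        = t * ∑ i, (Real.log (y i) - w i) * (z i - x i) := by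
      rw [Finset.mul_sum]
      refine Finset.sum_congr rfl fun i _ => ?_
      rw [show y i - x i = t * (z i - x i) by rw [hyi]; ring]; ring
    rw [h2] at h1
    have h3 := nonneg_of_mul_nonneg_right h1 ht0
    have h4 : ∑ i, (Real.log (y i) - w i) * (z i - x i)
        ≤ ∑ i, ((Real.log (z i) - w i) * (z i - x i) - if i = j then M * z j else 0) := by
      refine Finset.sum_le_sum fun i _ => ?_
      split_ifs with hij
      · subst hij
        rw [hyi, hj0]
        simp only [sub_zero, zero_add]
        rw [Real.log_mul ht0.ne' (hz i).ne', ht, Real.log_exp]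
        linarith
      · have : Real.log (y i) * (z i - x i) ≤ Real.log (z i) * (z i - x i) := by
          rcases le_total (x i) (z i) with h | h
          · refine mul_le_mul_of_nonneg_right (Real.log_le_log (hypos i) ?_) (by linarith)
            rw [hyi]; nlinarith
          · refine mul_le_mul_of_nonpos_right (Real.log_le_log (hz i) ?_) (by linarith)
            rw [hyi]; nlinarith
        linarith
    rw [Finset.sum_sub_distrib] at h4
    simp only [Finset.sum_ite_eq', Finset.mem_univ, if_true] at h4
    linarith
  have := key ((|C| + 1) / z j) (div_nonneg (by positivity) (hz j).le)
  rw [div_mul_cancel₀ _ (hz j).ne'] at this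
  linarith [le_abs_self C]

lemma min_stat {d m : ℕ} (A : Matrix (Fin m) (Fin d) ℝ) (b : Fin m → ℝ) (w x h : Fin d → ℝ)
    (hx : ∀ i, 0 < x i) (hxA : A.mulVec x = b) (hh : A.mulVec h = 0)
    (hmin : ∀ u : Fin d → ℝ, (∀ i, 0 ≤ u i) → A.mulVec u = b → Fent w x ≤ Fent w u) :
    ∑ i, h i * (Real.log (x i) - w i) = 0 := by
  have hd : HasDerivAt (fun t : ℝ => Fent w (fun i => x i + t * h i))
      (∑ i, h i * (Real.log (x i) - w i)) 0 := by
    unfold Fent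
    refine HasDerivAt.fun_sum fun i _ => ?_
    have h1 : HasDerivAt (fun t : ℝ => x i + t * h i) (h i) 0 := by
      simpa using ((hasDerivAt_id (0:ℝ)).mul_const (h i)).const_add (x i)
    have hne : x i + 0 * h i ≠ 0 := by simpa using (hx i).ne'
    have h2 := h1.fun_mul (((h1.log hne).sub_const 1).sub_const (w i))
    refine h2.congr_deriv ?_
    have := (hx i).ne'
    simp only [zero_mul, add_zero]
    field_simp
    ring
  refine IsLocalMin.hasDerivAt_eq_zero ?_ hd
  have hev : ∀ᶠ t : ℝ in nhds 0, ∀ i, 0 < x i + t * h i := by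
    rw [Filter.eventually_all]
    intro i
    have hc : ContinuousAt (fun t : ℝ => x i + t * h i) 0 := by fun_prop
    exact hc.eventually_const_lt (by simpa using hx i)
  filter_upwards [hev] with t ht
  have e : (fun i => x i + t * h i) = x + t • h := by ext i; simp
  have := hmin (fun i => x i + t * h i) (fun i => (ht i).le) (by
    rw [e, Matrix.mulVec_add, Matrix.mulVec_smul, hh, hxA]; simp)
  simpa using this

theorem proximal_eq_regularization {d m : ℕ}
    (A : Matrix (Fin m) (Fin d) ℝ) (b : Fin m → ℝ) (c : Fin d → ℝ)
    (β₀ : ℝ) (hβ₀ : 0 < β₀) (u₀ : Fin d → ℝ) (hu₀ : ∀ i, 0 < u₀ i)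
    (P : Set (Fin d → ℝ))
    (hP : P = {v | (∀ i, 0 ≤ v i) ∧ A.mulVec v = b})
    (hstrict : ∃ v ∈ P, ∀ i, 0 < v i)
    -- `vstar β` is the unique minimizer over `P` of `KL(v | u₀ ⬝ exp (-β c))`
    (vstar : ℝ → Fin d → ℝ)
    (hvstar : ∀ β > (0 : ℝ), vstar β ∈ P ∧ ∀ v ∈ P, v ≠ vstar β →
      KLvec d (vstar β) (fun i => u₀ i * Real.exp (-β * c i)) <
        KLvec d v (fun i => u₀ i * Real.exp (-β * c i)))
    -- proximal iterates: `v 0 = u₀` and `v (k+1)` is the unique minimizer over `P`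
    -- of `cᵀ v + β₀⁻¹ KL(v | v k)`
    (v : ℕ → Fin d → ℝ) (hv0 : v 0 = u₀)
    (hvk : ∀ k : ℕ, v (k + 1) ∈ P ∧ ∀ u ∈ P, u ≠ v (k + 1) →
      (∑ i, c i * v (k + 1) i) + β₀⁻¹ * KLvec d (v (k + 1)) (v k) <
        (∑ i, c i * u i) + β₀⁻¹ * KLvec d u (v k)) :
    ∀ k : ℕ, 1 ≤ k → v k = vstar (k * β₀) := by
  subst hP
  obtain ⟨z, ⟨-, hzA⟩, hz⟩ := hstrict
  -- optimality conditions
  have opt : ∀ w x : Fin d → ℝ, (∀ i, 0 ≤ x i) → A.mulVec x = b →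
      (∀ u : Fin d → ℝ, (∀ i, 0 ≤ u i) → A.mulVec u = b → Fent w x ≤ Fent w u) →
      (∀ i, 0 < x i) ∧ ∀ h : Fin d → ℝ, A.mulVec h = 0 →
        ∑ i, h i * (Real.log (x i) - w i) = 0 := by
    intro w x hx hxA hmin
    have hp := min_pos A b w x z hx hxA hz hzA hmin
    exact ⟨hp, fun h hh => min_stat A b w x h hp hxA hh hmin⟩
  have hiter : ∀ k : ℕ, (∀ i, 0 < v k i) ∧ ∀ h : Fin d → ℝ, A.mulVec h = 0 →
      ∑ i, h i * (Real.log (v k i) - (Real.log (u₀ i) - k * β₀ * c i)) = 0 := by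
    intro k
    induction k with
    | zero => subst hv0; exact ⟨hu₀, fun h _ => by simp⟩
    | succ k ih =>
      obtain ⟨ihp, ih⟩ := ih
      obtain ⟨⟨hn, hA⟩, hm⟩ := hvk k
      have e : ∀ u : Fin d → ℝ, (∑ i, c i * u i) + β₀⁻¹ * KLvec d u (v k)
          = β₀⁻¹ * Fent (fun i => Real.log (v k i) - β₀ * c i) u := by
        intro u
        rw [KLvec_eq _ _ ihp]
        unfold Fent
        rw [Finset.mul_sum, Finset.mul_sum, ← Finset.sum_add_distrib]
        refine Finset.sum_congr rfl fun i _ => ?_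
        field_simp
        ring
      obtain ⟨hp, hs⟩ := opt (fun i => Real.log (v k i) - β₀ * c i) (v (k + 1)) hn hA (by
        intro u hu huA
        by_cases hne : u = v (k + 1)
        · rw [hne]
        · have := hm u ⟨hu, huA⟩ hne
          rw [e, e] at this
          exact (lt_of_mul_lt_mul_left this (inv_pos.2 hβ₀).le).le)
      refine ⟨hp, fun h hh => ?_⟩
      have h1 := ih h hh
      have h2 := hs h hh
      rw [← add_zero (0 : ℝ)]
      nth_rewrite 1 [← h1]
      rw [← h2, ← Finset.sum_add_distrib]
      refine Finset.sum_congr rfl fun i _ => ?_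
      push_cast
      ring
  intro k hk
  have hkpos : (0 : ℝ) < k * β₀ := mul_pos (by exact_mod_cast hk) hβ₀
  obtain ⟨⟨hn, hA⟩, hm⟩ := hvstar (k * β₀) hkpos
  set y := vstar (k * β₀) with hy
  have hupos : ∀ i, 0 < u₀ i * Real.exp (-(k * β₀) * c i) :=
    fun i => mul_pos (hu₀ i) (Real.exp_pos _)
  obtain ⟨hyp, hys⟩ := opt (fun i => Real.log (u₀ i * Real.exp (-(k * β₀) * c i))) y hn hA (by
    intro u hu huA
    by_cases hne : u = y
    · rw [hne]
    · have := hm u ⟨hu, huA⟩ hne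
      rw [KLvec_eq _ _ hupos, KLvec_eq _ _ hupos] at this
      exact this.le)
  obtain ⟨hxp, hxs⟩ := hiter k
  have hxA : A.mulVec (v k) = b := by
    obtain ⟨l, rfl⟩ : ∃ l, k = l + 1 := ⟨k - 1, by omega⟩
    exact (hvk l).1.2
  have hh : A.mulVec (v k - y) = 0 := by rw [Matrix.mulVec_sub, hxA, hA, sub_self]
  have h1 := hxs _ hh
  have h2 := hys _ hh
  have h3 : ∑ i, (v k i - y i) * (Real.log (v k i) - Real.log (y i)) = 0 := by
    rw [← sub_zero (0 : ℝ)]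
    nth_rewrite 1 [← h1]
    rw [← h2, ← Finset.sum_sub_distrib]
    refine Finset.sum_congr rfl fun i _ => ?_
    rw [Real.log_mul (hu₀ i).ne' (Real.exp_pos _).ne', Real.log_exp]
    simp only [Pi.sub_apply]
    ring
  have h4 : ∀ i ∈ Finset.univ, 0 ≤ (v k i - y i) * (Real.log (v k i) - Real.log (y i)) := by
    intro i _
    rcases le_total (v k i) (y i) with h | h
    · exact mul_nonneg_of_nonpos_of_nonpos (by linarith)
        (by linarith [Real.log_le_log (hxp i) h])
    · exact mul_nonneg (by linarith) (by linarith [Real.log_le_log (hyp i) h])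
  have h5 := (Finset.sum_eq_zero_iff_of_nonneg h4).1 h3
  ext i
  rcases mul_eq_zero.1 (h5 i (Finset.mem_univ i)) with h | h
  · linarith
  · exact Real.log_injOn_pos (hxp i) (hyp i) (by linarith)
end

section
/- Let P = { v ∈ ℝ^d : v ≥ 0, Av = b } contain a strictly positive vector, let c ∈ ℝ^d, and let β₀ > 0. For β > 0 let v*_β denote the unique minimizer over P of KL(v | 𝟙 · exp(−βc)) = KL(v | exp(−βc)), where 𝟙 is the all-ones vector. Define iterates by v₀ = 𝟙 and v_{k+1} = the unique minimizer over P of cᵀv + β₀^{−1} KL(v | v_k · v_{k−1} · ⋯ · v₀) (elementwise products). Then for every k ≥ 1, v_k = v*_{2^{k−1} β₀}. -/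
lemma KLvec_pos {d : ℕ} (u w : Fin d → ℝ) (hw : ∀ i, 0 < w i) :
    KLvec d u w = (∑ i, (u i * Real.log (u i) - u i)) - ∑ i, u i * Real.log (w i) := by
  unfold KLvec
  rw [← Finset.sum_sub_distrib]
  refine Finset.sum_congr rfl fun i _ => ?_
  rcases eq_or_ne (u i) 0 with h | h
  · simp [h]
  · rw [Real.log_div h (hw i).ne']
    ring

lemma KLvec_exp {d : ℕ} (u c : Fin d → ℝ) (β : ℝ) :
    KLvec d u (fun i => Real.exp (-β * c i)) =
      (∑ i, (u i * Real.log (u i) - u i)) + β * ∑ i, c i * u i := by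
  rw [KLvec_pos u _ (fun i => Real.exp_pos _), Finset.mul_sum, sub_eq_add_neg,
    ← Finset.sum_neg_distrib]
  congr 1
  refine Finset.sum_congr rfl fun i _ => ?_
  rw [Real.log_exp]
  ring

/-- A minimizer is strictly positive. -/
lemma minimizer_pos {d : ℕ} (e x p : Fin d → ℝ) (hx : ∀ i, 0 ≤ x i) (hp : ∀ i, 0 < p i)
    (hmin : ∀ t : ℝ, 0 < t → t < 1 →
      (∑ i, (x i * Real.log (x i) + e i * x i)) ≤
      ∑ i, ((x i + t * (p i - x i)) * Real.log (x i + t * (p i - x i))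
        + e i * (x i + t * (p i - x i)))) :
    ∀ i, 0 < x i := by
  intro i₀
  by_contra hcon
  have h0 : x i₀ = 0 := le_antisymm (not_lt.mp hcon) (hx i₀)
  set D : ℝ := ∑ i, ((p i * Real.log (p i) + e i * p i) - (x i * Real.log (x i) + e i * x i))
    with hD
  have key : ∀ t : ℝ, 0 < t → t < 1 → 0 ≤ t * D + t * p i₀ * Real.log t := by
    intro t ht ht1
    have h1 := hmin t ht ht1
    have h2 : ∑ i, (((x i + t * (p i - x i)) * Real.log (x i + t * (p i - x i))
        + e i * (x i + t * (p i - x i))) - (x i * Real.log (x i) + e i * x i)) ≤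
        ∑ i, (t * ((p i * Real.log (p i) + e i * p i) - (x i * Real.log (x i) + e i * x i))
          + if i = i₀ then t * p i₀ * Real.log t else 0) := by
      refine Finset.sum_le_sum fun i _ => ?_
      split_ifs with h
      · subst h
        rw [h0]
        simp only [sub_zero, zero_add, zero_mul, mul_zero]
        rw [Real.log_mul ht.ne' (hp i).ne']
        apply le_of_eq
        ring
      · have := Real.convexOn_mul_log.2 (Set.mem_Ici.2 (hx i)) (Set.mem_Ici.2 (hp i).le)
          (sub_nonneg.2 ht1.le) ht.le (by ring)
        simp only [smul_eq_mul] at this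
        have e1 : (1 - t) * x i + t * p i = x i + t * (p i - x i) := by ring
        rw [e1] at this
        linarith
    rw [Finset.sum_add_distrib, ← Finset.mul_sum, ← hD, Finset.sum_sub_distrib] at h2
    simp at h2
    linarith
  have hS := hp i₀
  have hneg : -((|D| + 1) / p i₀) < 0 := by
    have : 0 < (|D| + 1) / p i₀ := by positivity
    linarith
  have h3 := key (Real.exp (-((|D| + 1) / p i₀))) (Real.exp_pos _) (by simpa using Real.exp_lt_exp.2 hneg)
  rw [Real.log_exp] at h3
  have ht := Real.exp_pos (-((|D| + 1) / p i₀))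
  set t := Real.exp (-((|D| + 1) / p i₀))
  have h4 : t * D + t * p i₀ * -((|D| + 1) / p i₀) = t * (D - |D| - 1) := by
    field_simp
    ring
  rw [h4] at h3
  have := le_abs_self D
  nlinarith

/-- First-order condition at a strictly positive minimizer. -/
lemma minimizer_foc {d : ℕ} (e x h : Fin d → ℝ) (hx : ∀ i, 0 < x i)
    (hmin : ∀ t : ℝ, (∀ i, 0 ≤ x i + t * h i) →
      (∑ i, ((x i * Real.log (x i) - x i) + e i * x i)) ≤
      ∑ i, (((x i + t * h i) * Real.log (x i + t * h i) - (x i + t * h i))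
        + e i * (x i + t * h i))) :
    ∑ i, h i * (Real.log (x i) + e i) = 0 := by
  set f : ℝ → ℝ := fun t => ∑ i, (((x i + t * h i) * Real.log (x i + t * h i) - (x i + t * h i))
        + e i * (x i + t * h i)) with hf
  have hloc : IsLocalMin f 0 := by
    have : ∀ᶠ t in nhds (0 : ℝ), ∀ i, 0 < x i + t * h i := by
      rw [Filter.eventually_all]
      intro i
      have hc : ContinuousAt (fun t : ℝ => x i + t * h i) 0 := by fun_prop
      exact hc.eventually (lt_mem_nhds (by simpa using hx i))
    filter_upwards [this] with t ht
    have := hmin t (fun i => (ht i).le)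
    simpa [hf] using this
  have hd : HasDerivAt f (∑ i, h i * (Real.log (x i) + e i)) 0 := by
    refine HasDerivAt.fun_sum fun i _ => ?_
    have hl : HasDerivAt (fun t : ℝ => x i + t * h i) (h i) 0 := by
      simpa using ((hasDerivAt_id (0 : ℝ)).mul_const (h i)).const_add (x i)
    have hm : HasDerivAt (fun s : ℝ => s * Real.log s) (Real.log (x i) + 1) (x i + 0 * h i) := by
      simpa using Real.hasDerivAt_mul_log (hx i).ne'
    have := ((hm.comp (0 : ℝ) hl).sub hl).add (hl.const_mul (e i))
    refine this.congr_deriv ?_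
    ring
  exact hloc.hasDerivAt_eq_zero hd

theorem product_update_eq_regularization {d m : ℕ}
    (A : Matrix (Fin m) (Fin d) ℝ) (b : Fin m → ℝ) (c : Fin d → ℝ)
    (β₀ : ℝ) (hβ₀ : 0 < β₀)
    (P : Set (Fin d → ℝ))
    (hP : P = {v | (∀ i, 0 ≤ v i) ∧ A.mulVec v = b})
    (hstrict : ∃ v ∈ P, ∀ i, 0 < v i)
    -- `vstar β` is the unique minimizer over `P` of `KL(v | exp (-β c))`
    (vstar : ℝ → Fin d → ℝ)
    (hvstar : ∀ β > (0 : ℝ), vstar β ∈ P ∧ ∀ v ∈ P, v ≠ vstar β →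
      KLvec d (vstar β) (fun i => Real.exp (-β * c i)) <
        KLvec d v (fun i => Real.exp (-β * c i)))
    -- iterates: `v 0 = 𝟙` and `v (k+1)` is the unique minimizer over `P` of
    -- `cᵀ v + β₀⁻¹ KL(v | v k ⬝ v (k-1) ⬝ ⋯ ⬝ v 0)` (elementwise product)
    (v : ℕ → Fin d → ℝ) (hv0 : v 0 = fun _ => 1)
    (hvk : ∀ k : ℕ, v (k + 1) ∈ P ∧ ∀ u ∈ P, u ≠ v (k + 1) →
      (∑ i, c i * v (k + 1) i) +
          β₀⁻¹ * KLvec d (v (k + 1)) (fun i => ∏ j ∈ Finset.range (k + 1), v j i) <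
        (∑ i, c i * u i) +
          β₀⁻¹ * KLvec d u (fun i => ∏ j ∈ Finset.range (k + 1), v j i)) :
    ∀ k : ℕ, 1 ≤ k → v k = vstar (2 ^ (k - 1) * β₀) := by
  have hx : ∀ β > (0 : ℝ), (∀ i, 0 < vstar β i) ∧ ∀ u ∈ P, ∀ y ∈ P,
      ∑ i, (u i - y i) * (Real.log (vstar β i) + β * c i) = 0 := by
    intro β hβ
    obtain ⟨hm, hmin⟩ := hvstar β hβ
    obtain ⟨p, hpP, hp⟩ := hstrict
    have hle : ∀ u ∈ P, (∑ i, ((vstar β i * Real.log (vstar β i) - vstar β i)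
        + β * c i * vstar β i)) ≤ ∑ i, ((u i * Real.log (u i) - u i) + β * c i * u i) := by
      intro u hu
      have h1 : KLvec d (vstar β) (fun i => Real.exp (-β * c i)) ≤
          KLvec d u (fun i => Real.exp (-β * c i)) := by
        by_cases h : u = vstar β
        · rw [h]
        · exact (hmin u hu h).le
      rw [KLvec_exp, KLvec_exp, Finset.mul_sum, Finset.mul_sum, ← Finset.sum_add_distrib,
        ← Finset.sum_add_distrib] at h1
      simpa only [mul_assoc] using h1
    have hmem := hm
    rw [hP] at hmem
    have hpmem := hpP
    rw [hP] at hpmem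
    have hpos : ∀ i, 0 < vstar β i := by
      refine minimizer_pos (fun i => β * c i - 1) (vstar β) p hmem.1 hp ?_
      intro t ht ht1
      have hq : (vstar β + t • (p - vstar β)) ∈ P := by
        rw [hP]
        refine ⟨fun i => ?_, ?_⟩
        · have h1 := hmem.1 i
          have h2 := hp i
          simp only [Pi.add_apply, Pi.smul_apply, Pi.sub_apply, smul_eq_mul]
          nlinarith
        · rw [Matrix.mulVec_add, Matrix.mulVec_smul, Matrix.mulVec_sub, hmem.2, hpmem.2]
          simp
      have h1 := hle _ hq
      simp only [Pi.add_apply, Pi.smul_apply, Pi.sub_apply, smul_eq_mul] at h1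
      convert h1 using 2 <;> ring
    refine ⟨hpos, fun u hu y hy => ?_⟩
    rw [hP] at hu hy
    refine minimizer_foc (fun i => β * c i) (vstar β) (fun i => u i - y i) hpos ?_
    intro t ht
    have hq : (vstar β + t • (u - y)) ∈ P := by
      rw [hP]
      refine ⟨fun i => by simpa using ht i, ?_⟩
      rw [Matrix.mulVec_add, Matrix.mulVec_smul, Matrix.mulVec_sub, hmem.2, hu.2, hy.2]
      simp
    simpa using hle _ hq
  have step : ∀ k : ℕ, ((∀ i, 0 < ∏ j ∈ Finset.range (k + 1), v j i) ∧ ∀ u ∈ P, ∀ y ∈ P,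
      ∑ i, (u i - y i) * (Real.log (∏ j ∈ Finset.range (k + 1), v j i)
        + (2 ^ k - 1) * β₀ * c i) = 0) → v (k + 1) = vstar (2 ^ k * β₀) := by
    intro k ⟨hw, hk⟩
    by_contra hne
    have hβ : (0 : ℝ) < 2 ^ k * β₀ := by positivity
    obtain ⟨hm, hmin⟩ := hvstar _ hβ
    obtain ⟨hm', hmin'⟩ := hvk k
    have h1 := hmin _ hm' hne
    have h2 := hmin' _ hm (Ne.symm hne)
    have h3 := hk _ hm _ hm'
    rw [KLvec_exp, KLvec_exp] at h1
    rw [KLvec_pos _ _ hw, KLvec_pos _ _ hw] at h2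
    have h4 := mul_lt_mul_of_pos_left h2 hβ₀
    simp only [mul_add, ← mul_assoc, mul_inv_cancel₀ hβ₀.ne', one_mul] at h4
    have h5 : ∀ u : Fin d → ℝ, ∑ i, u i * (Real.log (∏ j ∈ Finset.range (k + 1), v j i)
        + (2 ^ k - 1) * β₀ * c i) = ∑ i, u i * Real.log (∏ j ∈ Finset.range (k + 1), v j i)
        + (2 ^ k - 1) * β₀ * ∑ i, c i * u i := by
      intro u
      rw [Finset.mul_sum, ← Finset.sum_add_distrib]
      exact Finset.sum_congr rfl fun i _ => by ring
    simp only [sub_mul _ _ (_ + _)] at h3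
    rw [Finset.sum_sub_distrib, h5, h5] at h3
    linarith
  have inv : ∀ k : ℕ, ((∀ i, 0 < ∏ j ∈ Finset.range (k + 1), v j i) ∧ ∀ u ∈ P, ∀ y ∈ P,
      ∑ i, (u i - y i) * (Real.log (∏ j ∈ Finset.range (k + 1), v j i)
        + (2 ^ k - 1) * β₀ * c i) = 0) := by
    intro k
    induction k with
    | zero => simp [hv0]
    | succ k ih =>
      have he := step k ih
      obtain ⟨hpos, hfoc⟩ := hx (2 ^ k * β₀) (by positivity)
      rw [← he] at hpos hfoc
      refine ⟨fun i => ?_, fun u hu y hy => ?_⟩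
      · rw [Finset.prod_range_succ]
        exact mul_pos (ih.1 i) (hpos i)
      · have h1 := ih.2 u hu y hy
        have h2 := hfoc u hu y hy
        rw [← add_zero (0 : ℝ)]
        nth_rewrite 1 [← h1]
        rw [← h2, ← Finset.sum_add_distrib]
        refine Finset.sum_congr rfl fun i _ => ?_
        rw [Finset.prod_range_succ _ (k + 1), Real.log_mul (ih.1 i).ne' (hpos i).ne']
        ring
  intro k hk
  obtain ⟨n, rfl⟩ := Nat.exists_eq_add_of_le' hk
  simpa using step n (inv n)
end

section
/- Let A ∈ ℝ^{m×d}, b ∈ ℝ^m, and suppose the polytope P = { v ∈ ℝ^d : v ≥ 0, Av = b } contains a strictly positive vector. Let z ∈ ℝ^d be strictly positive and let v* be the minimizer of KL(v | z) over P. Then every entry of v* is strictly positive, and there exists λ ∈ ℝ^m such that v*_i = z_i · exp(−(Aᵀλ)_i) for every i. -/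
theorem kl_aux_convex (x y z : ℝ) (hx : 0 ≤ x) (hy : 0 < y) (hz : 0 < z) :
    y * (Real.log (y / z) - 1) - x * (Real.log (x / z) - 1) ≤ Real.log (y / z) * (y - x) := by
  rcases hx.eq_or_lt with rfl | hx
  · nlinarith
  · have h := Real.log_le_sub_one_of_pos (div_pos hy hx)
    rw [Real.log_div hy.ne' hx.ne'] at h
    rw [Real.log_div hy.ne' hz.ne', Real.log_div hx.ne' hz.ne']
    have h2 := mul_le_mul_of_nonneg_left h hx.le
    have h3 : x * (y / x - 1) = y - x := by field_simp
    rw [h3] at h2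
    nlinarith

theorem kl_aux_dir {d : ℕ} (z v h : Fin d → ℝ) (hz : ∀ i, 0 < z i) (hv : ∀ i, 0 ≤ v i)
    (t : ℝ) (ht : 0 < t) (hw : ∀ i, 0 < v i + t * h i)
    (hmin : KLvec d v z ≤ KLvec d (fun i => v i + t * h i) z) :
    0 ≤ ∑ i, Real.log ((v i + t * h i) / z i) * h i := by
  unfold KLvec at hmin
  have h1 : ∑ i, ((v i + t * h i) * (Real.log ((v i + t * h i) / z i) - 1)
      - v i * (Real.log (v i / z i) - 1)) ≤
      ∑ i, t * (Real.log ((v i + t * h i) / z i) * h i) := by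
    refine Finset.sum_le_sum fun i _ => ?_
    have := kl_aux_convex (v i) (v i + t * h i) (z i) (hv i) (hw i) (hz i)
    linarith
  rw [Finset.sum_sub_distrib, ← Finset.mul_sum] at h1
  have h2 : 0 ≤ t * ∑ i, Real.log ((v i + t * h i) / z i) * h i := by linarith
  exact nonneg_of_mul_nonneg_right h2 ht

theorem kl_aux_feas {d m : ℕ} (A : Matrix (Fin m) (Fin d) ℝ) (v h : Fin d → ℝ) (t : ℝ)
    (hh : A.mulVec h = 0) : A.mulVec (fun i => v i + t * h i) = A.mulVec v := by
  have : (fun i => v i + t * h i) = v + t • h := by ext i; simp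
  rw [this, Matrix.mulVec_add, Matrix.mulVec_smul, hh]; simp

theorem kl_minimizer_positive_and_KKT {d m : ℕ}
    (A : Matrix (Fin m) (Fin d) ℝ) (b : Fin m → ℝ)
    (P : Set (Fin d → ℝ))
    (hP : P = {v | (∀ i, 0 ≤ v i) ∧ A.mulVec v = b})
    (hstrict : ∃ v ∈ P, ∀ i, 0 < v i)
    (z : Fin d → ℝ) (hz : ∀ i, 0 < z i)
    (vstar : Fin d → ℝ) (hvP : vstar ∈ P)
    (hvmin : ∀ v ∈ P, KLvec d vstar z ≤ KLvec d v z) :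
    (∀ i, 0 < vstar i) ∧
      ∃ lam : Fin m → ℝ, ∀ i, vstar i = z i * Real.exp (-(A.transpose.mulVec lam) i) := by
  subst hP
  obtain ⟨hv0, hvA⟩ := hvP
  have hpos : ∀ i, 0 < vstar i := by
    obtain ⟨u, ⟨_, huA⟩, hu⟩ := hstrict
    by_contra hcon
    push Not at hcon
    obtain ⟨k, hk⟩ := hcon
    have hk0 : vstar k = 0 := le_antisymm hk (hv0 k)
    have hker : A.mulVec (u - vstar) = 0 := by rw [Matrix.mulVec_sub, huA, hvA, sub_self]
    set c : Fin d → ℝ := fun i => Real.log (u i / z i) * (u i - vstar i) with hc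
    set C := ∑ i, c i with hC
    set s : ℝ := (|C| + 1) / u k with hs
    have hspos : 0 < s := div_pos (by positivity) (hu k)
    set t := Real.exp (-s) with ht
    have ht0 : 0 < t := Real.exp_pos _
    have ht1 : t < 1 := by rw [ht, Real.exp_lt_one_iff]; linarith
    have hw : ∀ i, 0 < vstar i + t * (u - vstar) i := by
      intro i
      have h1 := mul_pos ht0 (hu i)
      have h2 := mul_nonneg (sub_nonneg.2 ht1.le) (hv0 i)
      simp only [Pi.sub_apply]
      nlinarith
    have h0 := kl_aux_dir z vstar (u - vstar) hz hv0 t ht0 hw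
      (hvmin _ ⟨fun i => (hw i).le, by rw [kl_aux_feas A _ _ _ hker, hvA]⟩)
    have hb : ∀ i, Real.log ((vstar i + t * (u - vstar) i) / z i) * (u - vstar) i ≤
        c i + (if i = k then -(|C| + 1) else 0) := by
      intro i
      split_ifs with hik
      · subst hik
        have e : (vstar i + t * (u - vstar) i) / z i = t * (u i / z i) := by
          simp [hk0]; ring
        rw [e, Real.log_mul ht0.ne' (div_pos (hu i) (hz i)).ne', ht, Real.log_exp]
        have : s * u i = |C| + 1 := by rw [hs]; field_simp [(hu i).ne']
        simp only [hc, Pi.sub_apply, hk0]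
        linarith
      · have hwi := hw i
        simp only [Pi.sub_apply, hc, add_zero] at hwi ⊢
        rcases le_total (vstar i) (u i) with hle | hle
        · refine mul_le_mul_of_nonneg_right (Real.log_le_log (div_pos hwi (hz i)) ?_) (by linarith)
          refine div_le_div_of_nonneg_right ?_ (hz i).le
          nlinarith
        · refine mul_le_mul_of_nonpos_right
            (Real.log_le_log (div_pos (hu i) (hz i)) ?_) (by linarith)
          refine div_le_div_of_nonneg_right ?_ (hz i).le
          nlinarith
    have h1 := h0.trans (Finset.sum_le_sum fun i _ => hb i)
    rw [Finset.sum_add_distrib, Finset.sum_ite_eq' Finset.univ k] at h1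
    simp only [Finset.mem_univ, if_true] at h1
    have := le_abs_self C
    linarith
  refine ⟨hpos, ?_⟩
  have hge : ∀ h : Fin d → ℝ, A.mulVec h = 0 → 0 ≤ ∑ i, Real.log (vstar i / z i) * h i := by
    intro h hh
    have hcont : ∀ i, Filter.Tendsto (fun t : ℝ => vstar i + t * h i)
        (nhdsWithin 0 (Set.Ioi 0)) (nhds (vstar i)) := by
      intro i
      have : Continuous (fun t : ℝ => vstar i + t * h i) := by fun_prop
      have h2 := this.tendsto 0
      simp only [zero_mul, add_zero] at h2
      exact h2.mono_left nhdsWithin_le_nhds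
    have hT : Filter.Tendsto (fun t : ℝ => ∑ i, Real.log ((vstar i + t * h i) / z i) * h i)
        (nhdsWithin 0 (Set.Ioi 0)) (nhds (∑ i, Real.log (vstar i / z i) * h i)) := by
      refine tendsto_finsetSum _ fun i _ => ?_
      exact (((hcont i).div_const (z i)).log (div_pos (hpos i) (hz i)).ne').mul_const _
    refine ge_of_tendsto hT ?_
    have hev : ∀ᶠ t in nhdsWithin (0 : ℝ) (Set.Ioi 0), ∀ i, 0 < vstar i + t * h i :=
      Filter.eventually_all.2 fun i => (hcont i).eventually (lt_mem_nhds (hpos i))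
    filter_upwards [hev, self_mem_nhdsWithin] with t hw ht
    exact kl_aux_dir z vstar h hz hv0 t ht hw
      (hvmin _ ⟨fun i => (hw i).le, by rw [kl_aux_feas A _ _ _ hh, hvA]⟩)
  have heq : ∀ h : Fin d → ℝ, A.mulVec h = 0 → ∑ i, Real.log (vstar i / z i) * h i = 0 := by
    intro h hh
    have h1 := hge h hh
    have h2 := hge (-h) (by rw [Matrix.mulVec_neg, hh, neg_zero])
    simp only [Pi.neg_apply, mul_neg, Finset.sum_neg_distrib] at h2
    linarith
  set g : Fin d → ℝ := fun i => Real.log (vstar i / z i) with hg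
  set φ : Module.Dual ℝ (Fin d → ℝ) := ∑ i, g i • LinearMap.proj i with hφ
  have hφa : ∀ h, φ h = ∑ i, g i * h i := by
    intro h
    simp [hφ, LinearMap.sum_apply]
  have hmem : φ ∈ (LinearMap.ker A.mulVecLin).dualAnnihilator := by
    rw [Submodule.mem_dualAnnihilator]
    intro h hh
    rw [hφa]
    exact heq h (by simpa using hh)
  rw [← LinearMap.range_dualMap_eq_dualAnnihilator_ker] at hmem
  obtain ⟨ψ, hψ⟩ := hmem
  refine ⟨fun j => -ψ (Pi.single j 1), fun i => ?_⟩
  have hgi : g i = ∑ j, A j i * ψ (Pi.single j 1) := by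
    have e1 : φ (Pi.single i 1) = g i := by
      rw [hφa]; simp [Pi.single_apply]
    rw [← e1, ← hψ, LinearMap.dualMap_apply, Matrix.mulVecLin_apply, Matrix.mulVec_single_one,
      LinearMap.pi_apply_eq_sum_univ]
    refine Finset.sum_congr rfl fun j _ => ?_
    have e2 : (fun l => if j = l then (1 : ℝ) else 0) = Pi.single j 1 := by
      ext l; simp [Pi.single_apply, eq_comm]
    rw [e2]; simp
  have hlam : -(A.transpose.mulVec (fun j => -ψ (Pi.single j 1))) i = g i := by
    rw [hgi]
    simp [Matrix.mulVec, dotProduct]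
  rw [hlam, hg, Real.exp_log (div_pos (hpos i) (hz i))]
  have := (hz i).ne'
  field_simp
end

section
/- Let n ≥ 2, and let Γ = { (i,j,i,l) : j ≠ l } ∪ { (j,i,l,i) : j ≠ l } be the set of gangster indices. For each permutation σ of {1,…,n} let x^σ be its permutation matrix and y(x^σ)_{ijkl} = x^σ_{ij} x^σ_{kl}. Define (x̄, ȳ) = (1/n!) ∑_σ (x^σ, y(x^σ)), the average over all n! permutations. Then (x̄, ȳ) ∈ JAP, ȳ_γ = 0 for every γ ∈ Γ, every entry of x̄ is strictly positive (indeed x̄_{ij} = 1/n), and ȳ_{ijkl} > 0 for every index (i,j,k,l) ∉ Γ. -/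
/-- The Johnson–Adams polytope JAP. -/
def JAP (n : ℕ) :
    Set ((Fin n → Fin n → ℝ) × (Fin n → Fin n → Fin n → Fin n → ℝ)) :=
  {p | (∀ i j, 0 ≤ p.1 i j) ∧ (∀ i j k l, 0 ≤ p.2 i j k l) ∧
    (∀ i, ∑ j, p.1 i j = 1) ∧ (∀ j, ∑ i, p.1 i j = 1) ∧
    (∀ i j k, ∑ l, p.2 i j k l = p.1 i j) ∧
    (∀ i j l, ∑ k, p.2 i j k l = p.1 i j) ∧
    (∀ i k l, ∑ j, p.2 i j k l = p.1 k l) ∧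
    (∀ j k l, ∑ i, p.2 i j k l = p.1 k l)}

/-- The set of gangster indices
`Γ = {(i,j,i,l) : j ≠ l} ∪ {(j,i,l,i) : j ≠ l}`. -/
def Gangster (n : ℕ) : Set (Fin n × Fin n × Fin n × Fin n) :=
  {γ | (∃ i j l, j ≠ l ∧ γ = (i, j, i, l)) ∨ (∃ i j l, j ≠ l ∧ γ = (j, i, l, i))}

/-- The permutation matrix of `σ`. -/
def permMat {n : ℕ} (σ : Equiv.Perm (Fin n)) : Fin n → Fin n → ℝ :=
  fun i j => if σ i = j then 1 else 0

theorem permMat_row {n : ℕ} (σ : Equiv.Perm (Fin n)) (i : Fin n) :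
    ∑ j, permMat σ i j = 1 := by
  simp [permMat]

theorem permMat_col {n : ℕ} (σ : Equiv.Perm (Fin n)) (j : Fin n) :
    ∑ i, permMat σ i j = 1 := by
  have h : ∀ i, permMat σ i j = if i = σ.symm j then 1 else 0 := by
    intro i
    simp only [permMat, Equiv.eq_symm_apply]
  simp [h]

theorem permMat_nonneg {n : ℕ} (σ : Equiv.Perm (Fin n)) (i j : Fin n) :
    0 ≤ permMat σ i j := by
  unfold permMat
  split_ifs <;> norm_num

theorem exists_perm_two {n : ℕ} (i j k l : Fin n) (h : i = k ↔ j = l) :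
    ∃ σ : Equiv.Perm (Fin n), σ i = j ∧ σ k = l := by
  by_cases hik : i = k
  · have hjl := h.1 hik
    subst hik hjl
    exact ⟨Equiv.swap i j, by simp, by simp⟩
  · have hjl : j ≠ l := fun e => hik (h.2 e)
    refine ⟨Equiv.swap (Equiv.swap i j k) l * Equiv.swap i j, ?_, ?_⟩
    · rw [Equiv.Perm.mul_apply, Equiv.swap_apply_left]
      apply Equiv.swap_apply_of_ne_of_ne _ hjl
      intro e
      apply hik
      apply (Equiv.swap i j).injective
      rw [Equiv.swap_apply_left]
      exact e
    · rw [Equiv.Perm.mul_apply, Equiv.swap_apply_left]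

theorem sum_permMat_const {n : ℕ} (i j j' : Fin n) :
    ∑ σ : Equiv.Perm (Fin n), permMat σ i j = ∑ σ : Equiv.Perm (Fin n), permMat σ i j' := by
  refine Fintype.sum_equiv (Equiv.mulLeft (Equiv.swap j j')) _ _ ?_
  intro σ
  have : Equiv.swap j j' (σ i) = j' ↔ σ i = j := by
    rw [Equiv.swap_apply_eq_iff, Equiv.swap_apply_right]
  simp [permMat, this]

theorem average_of_permutations {n : ℕ} (hn : 2 ≤ n)
    (xbar : Fin n → Fin n → ℝ) (ybar : Fin n → Fin n → Fin n → Fin n → ℝ)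
    (hxbar : ∀ i j, xbar i j =
      (1 / (Nat.factorial n : ℝ)) * ∑ σ : Equiv.Perm (Fin n), permMat σ i j)
    (hybar : ∀ i j k l, ybar i j k l =
      (1 / (Nat.factorial n : ℝ)) *
        ∑ σ : Equiv.Perm (Fin n), permMat σ i j * permMat σ k l) :
    (xbar, ybar) ∈ JAP n ∧
    (∀ γ ∈ Gangster n, ybar γ.1 γ.2.1 γ.2.2.1 γ.2.2.2 = 0) ∧
    (∀ i j, xbar i j = 1 / n) ∧ (∀ i j, 0 < xbar i j) ∧
    (∀ i j k l, (i, j, k, l) ∉ Gangster n → 0 < ybar i j k l) := by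
  have hf : (0 : ℝ) < 1 / (Nat.factorial n : ℝ) := by positivity
  have hf1 : (1 / (Nat.factorial n : ℝ)) * ∑ _σ : Equiv.Perm (Fin n), (1 : ℝ) = 1 := by
    have : (Nat.factorial n : ℝ) ≠ 0 := by positivity
    simp [Fintype.card_perm, this]
  have hn0 : (0 : ℝ) < n := by
    have : 0 < n := by omega
    exact_mod_cast this
  have hrow : ∀ i, ∑ j, xbar i j = 1 := by
    intro i
    simp only [hxbar]
    rw [← Finset.mul_sum, Finset.sum_comm]
    simpa only [permMat_row] using hf1
  have hcol : ∀ j, ∑ i, xbar i j = 1 := by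
    intro j
    simp only [hxbar]
    rw [← Finset.mul_sum, Finset.sum_comm]
    simpa only [permMat_col] using hf1
  have hx : ∀ i j, xbar i j = 1 / n := by
    intro i j
    have h1 : ∀ j', xbar i j' = xbar i j := by
      intro j'
      rw [hxbar, hxbar, sum_permMat_const i j' j]
    have h2 := hrow i
    simp only [h1] at h2
    rw [Finset.sum_const, Finset.card_univ, Fintype.card_fin, nsmul_eq_mul] at h2
    rw [eq_div_iff hn0.ne']
    linarith
  have hxpos : ∀ i j, 0 < xbar i j := by
    intro i j
    rw [hx]
    positivity
  refine ⟨⟨fun i j => (hxpos i j).le, ?_, hrow, hcol, ?_, ?_, ?_, ?_⟩, ?_, hx, hxpos, ?_⟩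
  · intro i j k l
    simp only [hybar]
    exact mul_nonneg hf.le (Finset.sum_nonneg fun σ _ =>
      mul_nonneg (permMat_nonneg _ _ _) (permMat_nonneg _ _ _))
  · intro i j k
    simp only [hybar, hxbar]
    rw [← Finset.mul_sum, Finset.sum_comm]
    simp only [← Finset.mul_sum, permMat_row, mul_one]
  · intro i j k
    simp only [hybar, hxbar]
    rw [← Finset.mul_sum, Finset.sum_comm]
    simp only [← Finset.mul_sum, permMat_col, mul_one]
  · intro i j k
    simp only [hybar, hxbar]
    rw [← Finset.mul_sum, Finset.sum_comm]
    simp only [← Finset.sum_mul, permMat_row, one_mul]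
  · intro i j k
    simp only [hybar, hxbar]
    rw [← Finset.mul_sum, Finset.sum_comm]
    simp only [← Finset.sum_mul, permMat_col, one_mul]
  · rintro γ (⟨i, j, l, hjl, rfl⟩ | ⟨i, j, l, hjl, rfl⟩)
    · simp only [hybar]
      rw [Finset.sum_eq_zero, mul_zero]
      intro σ _
      by_cases h : σ i = j
      · have : σ i ≠ l := fun e => hjl (h.symm.trans e)
        simp [permMat, this]
      · simp [permMat, h]
    · simp only [hybar]
      rw [Finset.sum_eq_zero, mul_zero]
      intro σ _
      by_cases h : σ j = i
      · have : σ l ≠ i := fun e => hjl (σ.injective (h.trans e.symm))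
        simp [permMat, this]
      · simp [permMat, h]
  · intro i j k l hG
    have hiff : i = k ↔ j = l := by
      constructor
      · intro e
        by_contra hne
        exact hG (Or.inl ⟨i, j, l, hne, by rw [e]⟩)
      · intro e
        by_contra hne
        exact hG (Or.inr ⟨j, i, k, hne, by rw [e]⟩)
    obtain ⟨σ, h1, h2⟩ := exists_perm_two i j k l hiff
    rw [hybar]
    refine mul_pos hf (Finset.sum_pos' (fun σ _ =>
      mul_nonneg (permMat_nonneg _ _ _) (permMat_nonneg _ _ _)) ⟨σ, Finset.mem_univ _, ?_⟩)
    simp [permMat, h1, h2]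
end
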